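/- For no integer n ≥ 8 divisible by 4 do there exist permutations σ₁, σ₂, σ₃ of {1,…,n} with σ₁σ₂σ₃ = 1, generating a subgroup that acts transitively on {1,…,n}, such that the full cycle type of σ₁ consists of n/2 copies of 2, the full cycle type of σ₂ consists of one 3, one 5, and (n−8)/4 copies of 4, and the full cycle type of σ₃ consists of n/4 copies of 4. (That is, the genus-1 ramification type [2^*][3,5,4^*][4^*] is not realizable in any degree.) -/

import Mathlib

/-- The full cycle type of a permutation of a finite set: the multiset of the lengths of its
cycles, where each fixed point counts as a cycle of length 1. -/
def fullCycleType {α : Type*} [Fintype α] [DecidableEq α] (σ : Equiv.Perm α) : Multiset ℕ :=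
  σ.cycleType + Multiset.replicate (Fintype.card α - σ.cycleType.sum) 1

/-- The subgroup generated by a set of permutations acts transitively. -/
def IsTransitiveSet {α : Type*} (s : Set (Equiv.Perm α)) : Prop :=
  ∀ x y : α, ∃ g ∈ Subgroup.closure s, g x = y

/-- A ramification data, given as a list of multisets of positive integers (partitions of `n`),
is realizable if there are permutations of `{1,…,n}` with product 1, generating a transitive
subgroup, whose full cycle types are the given multisets. -/
def Realizable (n : ℕ) (E : List (Multiset ℕ)) : Prop :=
  ∃ σ : List (Equiv.Perm (Fin n)),
    σ.map fullCycleType = E ∧ σ.prod = 1 ∧ IsTransitiveSet {g | g ∈ σ}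

section

open Equiv Function

/-- A permutation with cycles `(0 1 2)` and `(3 4 5 6 7)`. -/
def corner : Fin 8 → Fin 8 := ![1, 2, 0, 4, 5, 6, 7, 3]

/-- The boundary component through `h` of the ribbon graph with edges given by `m`. -/
def faceOrbit (m : Fin 8 → Fin 8) (h : Fin 8) : List (Fin 8) :=
  List.iterate (corner ∘ m) h 8

/-- The coefficient of the length of `x` in the difference of two sums of lengths. -/
def pairCoeff (l l' : List (Fin 8)) (x : Fin 8) : ℤ :=
  (if x ∈ l then 1 else 0) - (if x ∈ l' then 1 else 0)

/-- The linear form with coefficients `ε` is positive at all positive `m`-invariant lengths. -/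
def IsCert (m : Fin 8 → Fin 8) (ε : Fin 8 → ℤ) : Prop :=
  (∀ x, 0 ≤ ε x + ε (m x)) ∧ ∃ x, 0 < ε x + ε (m x)

instance (m : Fin 8 → Fin 8) (ε : Fin 8 → ℤ) : Decidable (IsCert m ε) := by
  unfold IsCert; infer_instance

/-- The components of `0` and `a`, and those of `r` and `s`, cannot simultaneously have equal
lengths. -/
def PairObstructed (m : Fin 8 → Fin 8) (a r s : Fin 8) : Prop :=
  ∃ u ∈ [(1 : ℤ), -1], ∃ v ∈ [(1 : ℤ), -1],
    IsCert m (fun x => u * pairCoeff (faceOrbit m 0) (faceOrbit m a) x +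
      v * pairCoeff (faceOrbit m r) (faceOrbit m s) x)

instance (m : Fin 8 → Fin 8) (a r s : Fin 8) : Decidable (PairObstructed m a r s) := by
  unfold PairObstructed; infer_instance

/-- However the component of `0` is paired with one of the same length, some component `r` cannot
be paired with any of the remaining ones. -/
def Obstructed (m : Fin 8 → Fin 8) : Prop :=
  ∀ a, a ∉ faceOrbit m 0 →
    (∃ u ∈ [(1 : ℤ), -1], IsCert m (fun x => u * pairCoeff (faceOrbit m 0) (faceOrbit m a) x)) ∨
    ∃ r, r ∉ faceOrbit m 0 ∧ r ∉ faceOrbit m a ∧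
      ∀ s, s ∉ faceOrbit m 0 → s ∉ faceOrbit m a → s ∉ faceOrbit m r →
        PairObstructed m a r s

set_option synthInstance.maxHeartbeats 0 in
set_option synthInstance.maxSize 10000 in
instance (m : Fin 8 → Fin 8) : Decidable (Obstructed m) := by
  unfold Obstructed; infer_instance

set_option maxRecDepth 100000 in
set_option synthInstance.maxHeartbeats 0 in
set_option synthInstance.maxSize 10000 in
theorem obstructed_of_matching :
    ∀ a0 : Fin 8, a0 ≠ 0 →
    ∀ a1 : Fin 8, a1 ≠ 1 → (a0 = 1 ↔ a1 = 0) →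
    ∀ a2 : Fin 8, a2 ≠ 2 → (a0 = 2 ↔ a2 = 0) → (a1 = 2 ↔ a2 = 1) →
    ∀ a3 : Fin 8, a3 ≠ 3 → (a0 = 3 ↔ a3 = 0) → (a1 = 3 ↔ a3 = 1) → (a2 = 3 ↔ a3 = 2) →
    ∀ a4 : Fin 8, a4 ≠ 4 → (a0 = 4 ↔ a4 = 0) → (a1 = 4 ↔ a4 = 1) → (a2 = 4 ↔ a4 = 2) →
      (a3 = 4 ↔ a4 = 3) →
    ∀ a5 : Fin 8, a5 ≠ 5 → (a0 = 5 ↔ a5 = 0) → (a1 = 5 ↔ a5 = 1) → (a2 = 5 ↔ a5 = 2) →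
      (a3 = 5 ↔ a5 = 3) → (a4 = 5 ↔ a5 = 4) →
    ∀ a6 : Fin 8, a6 ≠ 6 → (a0 = 6 ↔ a6 = 0) → (a1 = 6 ↔ a6 = 1) → (a2 = 6 ↔ a6 = 2) →
      (a3 = 6 ↔ a6 = 3) → (a4 = 6 ↔ a6 = 4) → (a5 = 6 ↔ a6 = 5) →
    ∀ a7 : Fin 8, a7 ≠ 7 → (a0 = 7 ↔ a7 = 0) → (a1 = 7 ↔ a7 = 1) → (a2 = 7 ↔ a7 = 2) →
      (a3 = 7 ↔ a7 = 3) → (a4 = 7 ↔ a7 = 4) → (a5 = 7 ↔ a7 = 5) → (a6 = 7 ↔ a7 = 6) →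
    Obstructed ![a0, a1, a2, a3, a4, a5, a6, a7] := by decide +kernel

theorem iterate_reversal {α : Type*} {R f : α → α} {S : Set α} (hS : ∀ x ∈ S, R x ∈ S)
    (hf : ∀ x ∈ S, R (f (R x)) = f x) (k : ℕ) : ∀ x ∈ S, R^[k] (f (R^[k] x)) = f x := by
  induction k with
  | zero => intro x _; rfl
  | succ k ih =>
    intro x hx
    rw [iterate_succ_apply' R k (f _), iterate_succ_apply R k x, ih _ (hS x hx), hf x hx]

theorem minimalPeriod_reversal {α : Type*} {R f : α → α} {S : Set α} (hR : Injective R)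
    (hf_inj : Injective f) (hS : ∀ x ∈ S, R x ∈ S) (hf : ∀ x ∈ S, R (f (R x)) = f x)
    {x : α} (hx : x ∈ S) : minimalPeriod R (f x) = minimalPeriod R x := by
  rw [minimalPeriod_eq_minimalPeriod_iff]
  intro k
  have h := iterate_reversal hS hf k x hx
  constructor
  · intro hk
    rw [IsPeriodicPt, IsFixedPt] at hk ⊢
    exact hf_inj (hR.iterate k (h.trans hk.symm))
  · intro hk
    rw [IsPeriodicPt, IsFixedPt] at hk ⊢
    rwa [hk] at h

theorem reversal_ne_iterate {α : Type*} {R f : α → α} {S : Set α} (hR : Injective R)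
    (hS : ∀ x ∈ S, R x ∈ S) (hf : ∀ x ∈ S, R (f (R x)) = f x) (h_zero : ∀ x ∈ S, f x ≠ x)
    (h_one : ∀ x ∈ S, f x ≠ R x) (k : ℕ) : ∀ x ∈ S, f x ≠ R^[k] x := by
  induction k using Nat.twoStepInduction with
  | zero => exact h_zero
  | one => exact h_one
  | more k ih _ =>
    intro x hx h
    refine ih (R x) (hS x hx) (hR ?_)
    rw [hf x hx, h, ← iterate_succ_apply' R, ← iterate_succ_apply]

theorem sameCycle_iff_exists_iterate {α : Type*} [Finite α] {R : Perm α} {x y : α} :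
    R.SameCycle x y ↔ ∃ k : ℕ, R^[k] x = y := by
  constructor
  · intro h
    obtain ⟨k, hk⟩ := h.exists_nat_pow_eq
    exact ⟨k, by rwa [Perm.iterate_eq_pow]⟩
  · rintro ⟨k, hk⟩
    exact ⟨k, by rwa [zpow_natCast, ← Perm.iterate_eq_pow]⟩

theorem minimalPeriod_eq_of_sameCycle {α : Type*} [Finite α] {R : Perm α} {x y : α}
    (h : R.SameCycle x y) : minimalPeriod R x = minimalPeriod R y := by
  obtain ⟨k, rfl⟩ := sameCycle_iff_exists_iterate.1 h
  exact (minimalPeriod_apply_iterate (R.injective.mem_periodicPts x) k).symm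

/-- The set of cycles of a permutation, fixed points included. -/
abbrev CycleQuotient {α : Type*} (R : Perm α) : Type _ := Quotient (Perm.SameCycle.setoid R)

theorem cycleQuotient_mk_eq {α : Type*} {R : Perm α} {x y : α} :
    (Quotient.mk _ x : CycleQuotient R) = Quotient.mk _ y ↔ R.SameCycle x y :=
  Quotient.eq (r := Perm.SameCycle.setoid R)

/-- A set of cycles that is preserved by a fixed-point-free involution which reverses cycles
has even cardinality. -/
theorem even_card_of_reversal {α : Type*} [Finite α] {R : Perm α} {f : α → α} {S : Set α}
    (hS : ∀ x ∈ S, R x ∈ S) (hf_inv : Involutive f) (hf : ∀ x ∈ S, R (f (R x)) = f x)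
    (h_zero : ∀ x ∈ S, f x ≠ x) (h_one : ∀ x ∈ S, f x ≠ R x) (X : Finset (CycleQuotient R))
    (hX : ∀ x, Quotient.mk _ x ∈ X → x ∈ S ∧ Quotient.mk _ (f x) ∈ X) : Even X.card := by
  have h_same : ∀ x ∈ S, ∀ y, R.SameCycle x y → R.SameCycle (f x) (f y) := by
    intro x hx y hxy
    obtain ⟨k, rfl⟩ := sameCycle_iff_exists_iterate.1 hxy
    exact (sameCycle_iff_exists_iterate.2 ⟨k, iterate_reversal hS hf k x hx⟩).symm
  have h_mem : ∀ q ∈ X, q.out ∈ S ∧ (Quotient.mk _ (f q.out) : CycleQuotient R) ∈ X := by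
    intro q hq
    exact hX _ (by rwa [Quotient.out_eq])
  have h_sum : ∑ _q ∈ X, (1 : ZMod 2) = 0 := by
    refine Finset.sum_involution (fun q _ => Quotient.mk _ (f q.out)) (fun _ _ => by decide) ?_
      (fun q hq => (h_mem q hq).2) ?_
    · intro q hq _ h_eq
      nth_rewrite 2 [← Quotient.out_eq q] at h_eq
      obtain ⟨k, hk⟩ := sameCycle_iff_exists_iterate.1 (cycleQuotient_mk_eq.1 h_eq.symm)
      exact reversal_ne_iterate R.injective hS hf h_zero h_one k _ (h_mem q hq).1 hk.symm
    · intro q hq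
      obtain ⟨hq_S, hq_X⟩ := h_mem q hq
      nth_rewrite 2 [← Quotient.out_eq q]
      rw [cycleQuotient_mk_eq]
      have h1 : R.SameCycle (f q.out) (Quotient.mk _ (f q.out) : CycleQuotient R).out :=
        cycleQuotient_mk_eq.1 (Quotient.out_eq _).symm
      have h2 := h_same _ (hX _ hq_X).1 _ h1
      rw [hf_inv] at h2
      exact h2.symm
  rw [Finset.sum_const, nsmul_one] at h_sum
  exact (ZMod.natCast_eq_zero_iff_even).1 h_sum

/-- Let `R = κ * ι` where `ι` is a fixed-point-free involution and `κ` is a fixed-point-free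
permutation restricting to an involution off `H`. If some fixed-point-free involution reverses
all cycles of `R`, then for each length the number of cycles of `R` meeting `H` is even. -/
theorem exists_cycle_of_odd_card {α : Type*} [Fintype α] {R ι κ J : Perm α} {H : Set α}
    (hR : R = κ * ι) (hι : Involutive ι) (hι_ne : ∀ x, ι x ≠ x) (hκ_ne : ∀ x, κ x ≠ x)
    (hH : ∀ x, κ x ∈ H ↔ x ∈ H) (hκ : ∀ x, x ∉ H → κ (κ x) = x)
    (hJ : Involutive J) (hJ_ne : ∀ x, J x ≠ x) (hJR : ∀ x, R (J (R x)) = J x)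
    (hJ_ne' : ∀ x, J x ≠ R x)
    (T : Finset (CycleQuotient R)) (hT : Odd T.card) (L : ℕ)
    (hTH : ∀ q ∈ T, ∃ x ∈ H, Quotient.mk _ x = q ∧ minimalPeriod R x = L) :
    ∃ x ∈ H, Quotient.mk _ x ∉ T ∧ minimalPeriod R x = L := by
  classical
  by_contra! h_none
  let S : Set α := {x | ∀ y, R.SameCycle x y → y ∉ H}
  have hS : ∀ x ∈ S, ∀ y, R.SameCycle x y → y ∈ S :=
    fun x hx y hxy z hyz => hx z (hxy.trans hyz)
  have hS_R : ∀ x ∈ S, R x ∈ S := fun x hx => hS x hx _ ⟨1, by simp⟩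
  have hS_notMem : ∀ x ∈ S, ι x ∉ H := by
    intro x hx
    rw [← hH]
    exact hx _ ⟨1, by simp [hR]⟩
  have hι_rev : ∀ x ∈ S, R (ι (R x)) = ι x := by
    intro x hx
    simp only [hR, Perm.mul_apply]
    rw [hι, hκ _ (hS_notMem x hx)]
  have hι_S : ∀ x ∈ S, ι x ∈ S := by
    intro x hx y hxy
    obtain ⟨k, rfl⟩ := sameCycle_iff_exists_iterate.1 hxy
    have hz : (R ^ k)⁻¹ x ∈ S := hS x hx _ ⟨-k, by simp⟩
    have h := iterate_reversal hS_R hι_rev k _ hz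
    have hz' : R^[k] ((R ^ k)⁻¹ x) = x := by simp [Perm.iterate_eq_pow]
    rw [hz'] at h
    rw [h]
    exact hS_notMem _ hz
  let X : Finset (CycleQuotient R) := Finset.univ.filter fun q => minimalPeriod R q.out = L
  have hX : ∀ x, Quotient.mk _ x ∈ X ↔ minimalPeriod R x = L := by
    intro x
    simp only [X, Finset.mem_filter, Finset.mem_univ, true_and]
    rw [minimalPeriod_eq_of_sameCycle (cycleQuotient_mk_eq.1 (Quotient.out_eq (Quotient.mk _ x)))]
  have hX_even : Even X.card := by
    refine even_card_of_reversal (R := R) (S := Set.univ) (fun _ _ => trivial) hJ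
      (fun x _ => hJR x) (fun x _ => hJ_ne x) (fun x _ => hJ_ne' x) X fun x hx => ⟨trivial, ?_⟩
    rw [hX] at hx ⊢
    rw [← hx]
    exact minimalPeriod_reversal (S := Set.univ) R.injective J.injective (fun _ _ => trivial)
      (fun x _ => hJR x) trivial
  have hTX : T ⊆ X := by
    intro q hq
    obtain ⟨x, -, rfl, hx⟩ := hTH q hq
    exact (hX x).2 hx
  have h_diff : Even (X \ T).card := by
    refine even_card_of_reversal (R := R) (S := S) hS_R hι hι_rev (fun x _ => hι_ne x) ?_ _ ?_
    · intro x _ h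
      refine hκ_ne (ι x) (Eq.symm ?_)
      rwa [hR] at h
    · intro x hx
      rw [Finset.mem_sdiff, hX] at hx
      have hxS : x ∈ S := by
        intro y hxy hy
        refine h_none y hy ?_ ?_
        · rw [← cycleQuotient_mk_eq.2 hxy]
          exact hx.2
        · rw [← minimalPeriod_eq_of_sameCycle hxy]
          exact hx.1
      refine ⟨hxS, Finset.mem_sdiff.2 ⟨?_, ?_⟩⟩
      · rw [hX, minimalPeriod_reversal R.injective ι.injective hS_R hι_rev hxS]
        exact hx.1
      · intro h_mem
        obtain ⟨y, hy, hyx, -⟩ := hTH _ h_mem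
        exact hι_S x hxS y (cycleQuotient_mk_eq.1 hyx).symm hy
  have h_card := Finset.card_sdiff_add_card_eq_card hTX
  rw [← h_card, Nat.even_add] at hX_even
  exact Nat.not_even_iff_odd.2 hT (hX_even.1 h_diff)

/-- Going along the cycle of `κ * ι` through `x ∈ H`, the first return to `H` after `k` steps
happens at `κ y`. -/
def FirstReturn {α : Type*} (ι κ : Perm α) (H : Set α) (x : α) (k : ℕ) (y : α) : Prop :=
  0 < k ∧ (κ * ι)^[k] x = κ y ∧ ∀ j, 0 < j → j < k → (κ * ι)^[j] x ∉ H

section FirstReturn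

variable {α : Type*} {ι κ : Perm α} {H : Set α} {x y : α} {k : ℕ}

theorem FirstReturn.iterate_eq (hι : Involutive ι) (hH : ∀ x, κ x ∈ H ↔ x ∈ H)
    (hκ : ∀ x, x ∉ H → κ (κ x) = x) (h : FirstReturn ι κ H x k y) :
    ∀ j < k, (κ * ι)^[j] y = ι ((κ * ι)^[k - 1 - j] x) := by
  obtain ⟨hk, hy, hj⟩ := h
  intro j
  induction j with
  | zero =>
    intro _
    obtain ⟨l, rfl⟩ := Nat.exists_eq_succ_of_ne_zero hk.ne'
    rw [iterate_succ_apply'] at hy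
    exact (κ.injective hy).symm
  | succ j ih =>
    intro hjk
    obtain ⟨l, hl⟩ : ∃ l, k - 1 - j = l + 1 := ⟨k - 1 - j - 1, by omega⟩
    have hl' : k - 1 - (j + 1) = l := by omega
    have h_notMem := hj (l + 1) (by omega) (by omega)
    rw [iterate_succ_apply', ih (by omega), hl, hl', Perm.mul_apply, hι, iterate_succ_apply',
      Perm.mul_apply]
    rw [iterate_succ_apply', Perm.mul_apply, hH] at h_notMem
    exact hκ _ h_notMem

theorem FirstReturn.symm (hι : Involutive ι) (hH : ∀ x, κ x ∈ H ↔ x ∈ H)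
    (hκ : ∀ x, x ∉ H → κ (κ x) = x) (h : FirstReturn ι κ H x k y) :
    FirstReturn ι κ H y k x := by
  have h_iter := h.iterate_eq hι hH hκ
  obtain ⟨hk, -, hj⟩ := h
  refine ⟨hk, ?_, ?_⟩
  · obtain ⟨l, rfl⟩ := Nat.exists_eq_succ_of_ne_zero hk.ne'
    rw [iterate_succ_apply', h_iter l (by omega)]
    simp [hι _]
  · intro j hj0 hjk
    rw [h_iter j hjk, ← hH]
    have h_notMem := hj (k - j) (by omega) (by omega)
    have : k - j = k - 1 - j + 1 := by omega
    rwa [this, iterate_succ_apply', Perm.mul_apply] at h_notMem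

theorem FirstReturn.ne (hι : Involutive ι) (hι_ne : ∀ x, ι x ≠ x) (hκ_ne : ∀ x, κ x ≠ x)
    (hH : ∀ x, κ x ∈ H ↔ x ∈ H) (hκ : ∀ x, x ∉ H → κ (κ x) = x)
    (h : FirstReturn ι κ H x k y) : y ≠ x := by
  rintro rfl
  have h_iter := h.iterate_eq hι hH hκ
  obtain ⟨hk, -, -⟩ := h
  obtain ⟨l, hl | hl⟩ := Nat.even_or_odd' (k - 1)
  · have := h_iter l (by omega)
    rw [show k - 1 - l = l by omega] at this
    exact hι_ne _ this.symm
  · have := h_iter l (by omega)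
    rw [show k - 1 - l = l + 1 by omega, iterate_succ_apply', Perm.mul_apply] at this
    have h' := congrArg ι this
    rw [hι] at h'
    exact hκ_ne _ h'.symm

theorem FirstReturn.unique (hH : ∀ x, κ x ∈ H ↔ x ∈ H) {l : ℕ} {z : α} (hy : y ∈ H) (hz : z ∈ H)
    (h : FirstReturn ι κ H x k y) (h' : FirstReturn ι κ H x l z) : k = l ∧ y = z := by
  have hkl : k = l := by
    rcases lt_trichotomy k l with hlt | heq | hlt
    · exact absurd (by rw [h.2.1, hH]; exact hy) (h'.2.2 k h.1 hlt)
    · exact heq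
    · exact absurd (by rw [h'.2.1, hH]; exact hz) (h.2.2 l h'.1 hlt)
  subst hkl
  exact ⟨rfl, κ.injective (h.2.1.symm.trans h'.2.1)⟩

theorem exists_firstReturn [Finite α] (hH : ∀ x, κ x ∈ H ↔ x ∈ H) (hx : x ∈ H) :
    ∃ k, ∃ y ∈ H, FirstReturn ι κ H x k y := by
  classical
  have h_ex : ∃ k, 0 < k ∧ (κ * ι)^[k] x ∈ H :=
    ⟨orderOf (κ * ι), orderOf_pos _, by rwa [Perm.iterate_eq_pow, pow_orderOf_eq_one]⟩
  obtain ⟨hk, hkH⟩ := Nat.find_spec h_ex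
  refine ⟨Nat.find h_ex, κ⁻¹ ((κ * ι)^[Nat.find h_ex] x), ?_, hk, by simp, ?_⟩
  · rw [← hH]
    simpa using hkH
  · intro j hj hjk hjH
    exact Nat.find_min h_ex hjk ⟨hj, hjH⟩

end FirstReturn

/-- The first return map matches the points of `H` in pairs. -/
theorem exists_matching {α β : Type*} [Finite α] {ι κ : Perm α} {e : β → α}
    (he : Injective e) (hι : Involutive ι) (hι_ne : ∀ x, ι x ≠ x) (hκ_ne : ∀ x, κ x ≠ x)
    (hH : ∀ x, κ x ∈ Set.range e ↔ x ∈ Set.range e)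
    (hκ : ∀ x, x ∉ Set.range e → κ (κ x) = x) :
    ∃ (m : β → β) (N : β → ℕ), Involutive m ∧ (∀ i, m i ≠ i) ∧ (∀ i, N (m i) = N i) ∧
      ∀ i, FirstReturn ι κ (Set.range e) (e i) (N i) (e (m i)) := by
  have h_ex : ∀ i, ∃ k j, FirstReturn ι κ (Set.range e) (e i) k (e j) := by
    intro i
    obtain ⟨k, _, ⟨j, rfl⟩, h⟩ := exists_firstReturn (ι := ι) hH ⟨i, rfl⟩
    exact ⟨k, j, h⟩
  choose N m h using h_ex
  have h_unique : ∀ i, N (m i) = N i ∧ e (m (m i)) = e i := fun i =>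
    (h (m i)).unique hH ⟨_, rfl⟩ ⟨_, rfl⟩ ((h i).symm hι hH hκ)
  exact ⟨m, N, fun i => he (h_unique i).2,
    fun i hi => (h i).ne hι hι_ne hκ_ne hH hκ (congrArg e hi), fun i => (h_unique i).1, h⟩

section ReturnMap

variable {α β : Type*} {R : α → α} {e : β → α} {P : β → β} {N : β → ℕ}

theorem iterate_sum_return (hP : ∀ i, R^[N i] (e i) = e (P i)) (k : ℕ) :
    ∀ i, R^[∑ j ∈ Finset.range k, N (P^[j] i)] (e i) = e (P^[k] i) := by
  induction k with
  | zero => intro i; rfl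
  | succ k ih =>
    intro i
    rw [Finset.sum_range_succ, add_comm, iterate_add_apply, ih, hP, iterate_succ_apply']

theorem exists_eq_sum_return (he : Injective e) (hP : ∀ i, R^[N i] (e i) = e (P i))
    (hN : ∀ i j, 0 < j → j < N i → R^[j] (e i) ∉ Set.range e) (hN_pos : ∀ i, 0 < N i)
    (i' : β) (t : ℕ) : ∀ i, R^[t] (e i) = e i' →
      ∃ k, t = ∑ j ∈ Finset.range k, N (P^[j] i) ∧ P^[k] i = i' := by
  induction t using Nat.strong_induction_on with
  | _ t ih =>
    intro i ht
    rcases Nat.eq_zero_or_pos t with rfl | ht_pos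
    · exact ⟨0, rfl, he ht⟩
    · have h_le : N i ≤ t := by
        by_contra! h_lt
        exact hN i t ht_pos h_lt ⟨i', ht.symm⟩
      obtain ⟨s, rfl⟩ := Nat.exists_eq_add_of_le' h_le
      rw [iterate_add_apply, hP] at ht
      obtain ⟨k, hk, hk'⟩ := ih s (by have := hN_pos i; omega) (P i) ht
      refine ⟨k + 1, ?_, by rwa [iterate_succ_apply]⟩
      rw [Finset.sum_range_succ', hk]
      rfl

theorem minimalPeriod_eq_sum_return (he : Injective e) (hP : ∀ i, R^[N i] (e i) = e (P i))
    (hN : ∀ i j, 0 < j → j < N i → R^[j] (e i) ∉ Set.range e) (hN_pos : ∀ i, 0 < N i)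
    (i : β) (hi : e i ∈ periodicPts R) :
    i ∈ periodicPts P ∧
      minimalPeriod R (e i) = ∑ j ∈ Finset.range (minimalPeriod P i), N (P^[j] i) := by
  have hT_pos := minimalPeriod_pos_of_mem_periodicPts hi
  obtain ⟨k, hk, hki⟩ := exists_eq_sum_return he hP hN hN_pos i _ i (iterate_minimalPeriod (f := R))
  have hk_pos : 0 < k := by
    rcases Nat.eq_zero_or_pos k with rfl | h
    · simp at hk; omega
    · exact h
  have h_per : i ∈ periodicPts P := mk_mem_periodicPts hk_pos hki
  refine ⟨h_per, le_antisymm ?_ ?_⟩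
  · refine IsPeriodicPt.minimalPeriod_le ?_ ?_
    · exact Finset.sum_pos (fun _ _ => hN_pos _)
        (Finset.nonempty_range_iff.2 (minimalPeriod_pos_of_mem_periodicPts h_per).ne')
    · rw [IsPeriodicPt, IsFixedPt, iterate_sum_return hP, iterate_minimalPeriod]
  · rw [hk]
    exact Finset.sum_le_sum_of_subset
      (Finset.range_mono (IsPeriodicPt.minimalPeriod_le hk_pos hki))

end ReturnMap

theorem mem_faceOrbit {m : Fin 8 → Fin 8} {i j : Fin 8} :
    j ∈ faceOrbit m i ↔ ∃ k < 8, j = (corner ∘ m)^[k] i := by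
  rw [faceOrbit, List.mem_iterate]

theorem obstructed_of_involutive {m : Fin 8 → Fin 8} (hm : Involutive m) (hm_ne : ∀ i, m i ≠ i) :
    Obstructed m := by
  have h : ∀ i j, m i = j ↔ m j = i := fun i j =>
    ⟨fun h => by rw [← h, hm], fun h => by rw [← h, hm]⟩
  have hm_eq : m = ![m 0, m 1, m 2, m 3, m 4, m 5, m 6, m 7] := by
    funext i
    fin_cases i <;> rfl
  rw [hm_eq]
  exact obstructed_of_matching _ (hm_ne _) _ (hm_ne _) (h _ _) _ (hm_ne _) (h _ _) (h _ _)
    _ (hm_ne _) (h _ _) (h _ _) (h _ _) _ (hm_ne _) (h _ _) (h _ _) (h _ _) (h _ _)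
    _ (hm_ne _) (h _ _) (h _ _) (h _ _) (h _ _) (h _ _)
    _ (hm_ne _) (h _ _) (h _ _) (h _ _) (h _ _) (h _ _) (h _ _)
    _ (hm_ne _) (h _ _) (h _ _) (h _ _) (h _ _) (h _ _) (h _ _) (h _ _)

theorem sum_pairCoeff (l l' : List (Fin 8)) (N : Fin 8 → ℕ) :
    ∑ x, pairCoeff l l' x * N x =
      ((∑ x ∈ l.toFinset, N x : ℕ) : ℤ) - ((∑ x ∈ l'.toFinset, N x : ℕ) : ℤ) := by
  have h : ∀ l : List (Fin 8),
      ∑ x, (if x ∈ l then 1 else 0) * (N x : ℤ) = ((∑ x ∈ l.toFinset, N x : ℕ) : ℤ) := by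
    intro l
    simp only [ite_mul, one_mul, zero_mul, Nat.cast_sum]
    rw [← Finset.sum_filter]
    congr 1
    ext x
    simp
  simp only [pairCoeff, sub_mul, Finset.sum_sub_distrib, h]

theorem IsCert.sum_ne_zero {m : Fin 8 → Fin 8} {ε : Fin 8 → ℤ} (h : IsCert m ε)
    (hm : Involutive m) {N : Fin 8 → ℕ} (hN : ∀ i, N (m i) = N i) (hN_pos : ∀ i, 0 < N i) :
    ∑ x, ε x * N x ≠ 0 := by
  obtain ⟨h_nonneg, x, hx⟩ := h
  have h_sum : ∑ x, ε (m x) * (N x : ℤ) = ∑ x, ε x * N x := by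
    rw [← Equiv.sum_comp hm.toPerm]
    simp [hm _, hN]
  have h_pos : 0 < ∑ x, (ε x + ε (m x)) * (N x : ℤ) :=
    Finset.sum_pos' (fun y _ => mul_nonneg (h_nonneg y) (by positivity))
      ⟨x, Finset.mem_univ _, mul_pos hx (by exact_mod_cast hN_pos x)⟩
  simp only [add_mul, Finset.sum_add_distrib, h_sum] at h_pos
  omega

/-- Lengths of the edges of a ribbon graph with matching `m` cannot be chosen so that for every
length the number of boundary components of that length is even. -/
theorem false_of_even_faces {m : Fin 8 → Fin 8} (hm : Involutive m) (hm_ne : ∀ i, m i ≠ i)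
    {N : Fin 8 → ℕ} (hN : ∀ i, N (m i) = N i) (hN_pos : ∀ i, 0 < N i) {W : Fin 8 → ℕ}
    (hW : ∀ i, W i = ∑ x ∈ (faceOrbit m i).toFinset, N x)
    (hW_eq : ∀ i j, i ∈ faceOrbit m j → W i = W j)
    (h_one : ∀ i, ∃ j, j ∉ faceOrbit m i ∧ W j = W i)
    (h_three : ∀ i j k, j ∉ faceOrbit m i → k ∉ faceOrbit m i → k ∉ faceOrbit m j →
      W j = W i → W k = W i →
      ∃ l, l ∉ faceOrbit m i ∧ l ∉ faceOrbit m j ∧ l ∉ faceOrbit m k ∧ W l = W i) : False := by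
  have h_sum : ∀ i j, W j = W i →
      ∑ x, pairCoeff (faceOrbit m i) (faceOrbit m j) x * N x = 0 := by
    intro i j hij
    rw [sum_pairCoeff, ← hW, ← hW, hij, sub_self]
  obtain ⟨a, ha, haW⟩ := h_one 0
  rcases obstructed_of_involutive hm hm_ne a ha with ⟨u, -, hu⟩ | ⟨r, hr0, hra, hr⟩
  · refine hu.sum_ne_zero hm hN hN_pos ?_
    simp only [mul_assoc, ← Finset.mul_sum, h_sum _ _ haW, mul_zero]
  · obtain ⟨s, hs0, hsa, hsr, hsW⟩ : ∃ s, s ∉ faceOrbit m 0 ∧ s ∉ faceOrbit m a ∧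
        s ∉ faceOrbit m r ∧ W s = W r := by
      by_cases hrW : W r = W 0
      · rw [hrW]
        exact h_three 0 a r ha hr0 hra haW hrW
      · obtain ⟨s, hsr, hsW⟩ := h_one r
        refine ⟨s, fun h => hrW ?_, fun h => hrW ?_, hsr, hsW⟩
        · rw [← hsW, hW_eq _ _ h]
        · rw [← hsW, hW_eq _ _ h, haW]
    obtain ⟨u, -, v, -, huv⟩ := hr s hs0 hsa hsr
    refine huv.sum_ne_zero hm hN hN_pos ?_
    simp only [add_mul, Finset.sum_add_distrib, mul_assoc, ← Finset.mul_sum, h_sum _ _ haW,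
      h_sum _ _ hsW, mul_zero, add_zero]

/-- A fixed-point-free involution cannot reverse all cycles of the product of `ι` with `κ`, when
`κ` has a 3-cycle, a 5-cycle and otherwise only 2-cycles. -/
theorem false_of_reversal {α : Type*} [Fintype α] {R ι κ J : Perm α} {e : Fin 8 → α}
    (he : Injective e) (h_corner : ∀ i, κ (e i) = e (corner i)) (hR : R = κ * ι)
    (hι : Involutive ι) (hι_ne : ∀ x, ι x ≠ x) (hκ_ne : ∀ x, κ x ≠ x)
    (hκ : ∀ x, x ∉ Set.range e → κ (κ x) = x)
    (hJ : Involutive J) (hJ_ne : ∀ x, J x ≠ x) (hJR : ∀ x, R (J (R x)) = J x)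
    (hJ_ne' : ∀ x, J x ≠ R x) : False := by
  classical
  have hH : ∀ x, κ x ∈ Set.range e ↔ x ∈ Set.range e := by
    have h_surj : ∀ i, ∃ j, corner j = i := by decide
    intro x
    constructor
    · rintro ⟨i, hi⟩
      obtain ⟨j, rfl⟩ := h_surj i
      exact ⟨j, κ.injective (by rw [h_corner, hi])⟩
    · rintro ⟨i, rfl⟩
      exact ⟨_, (h_corner i).symm⟩
  obtain ⟨m, N, hm, hm_ne, hNm, h_ret⟩ := exists_matching he hι hι_ne hκ_ne hH hκ
  have hP : ∀ i, R^[N i] (e i) = e ((corner ∘ m) i) := by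
    intro i
    rw [hR, (h_ret i).2.1, h_corner, comp_apply]
  have hN : ∀ i j, 0 < j → j < N i → R^[j] (e i) ∉ Set.range e := by
    intro i
    rw [hR]
    exact (h_ret i).2.2
  have hN_pos : ∀ i, 0 < N i := fun i => (h_ret i).1
  have h_per := fun i =>
    minimalPeriod_eq_sum_return he hP hN hN_pos i (R.injective.mem_periodicPts _)
  have h_le : ∀ i, minimalPeriod (corner ∘ m) i ≤ 8 := by
    intro i
    have h := Finset.card_le_card_of_injOn (s := Finset.range (minimalPeriod (corner ∘ m) i))
      (t := Finset.univ) (fun k => (corner ∘ m)^[k] i) (fun _ _ => Finset.mem_univ _)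
      (by simpa using iterate_injOn_Iio_minimalPeriod)
    simpa using h
  have h_lt : ∀ i k, k % minimalPeriod (corner ∘ m) i < minimalPeriod (corner ∘ m) i :=
    fun i k => Nat.mod_lt _ (minimalPeriod_pos_of_mem_periodicPts (h_per i).1)
  have h_mem : ∀ i j, j ∈ faceOrbit m i ↔ R.SameCycle (e i) (e j) := by
    intro i j
    rw [mem_faceOrbit, sameCycle_iff_exists_iterate]
    constructor
    · rintro ⟨k, -, rfl⟩
      exact ⟨_, iterate_sum_return hP k i⟩
    · rintro ⟨t, ht⟩
      obtain ⟨k, -, rfl⟩ := exists_eq_sum_return he hP hN hN_pos j t i ht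
      exact ⟨_, (h_lt i k).trans_le (h_le i), (iterate_mod_minimalPeriod_eq).symm⟩
  have hW : ∀ i, minimalPeriod R (e i) = ∑ x ∈ (faceOrbit m i).toFinset, N x := by
    intro i
    have h_image : (faceOrbit m i).toFinset =
        (Finset.range (minimalPeriod (corner ∘ m) i)).image fun k => (corner ∘ m)^[k] i := by
      ext j
      rw [List.mem_toFinset, mem_faceOrbit, Finset.mem_image]
      constructor
      · rintro ⟨k, -, rfl⟩
        exact ⟨_, Finset.mem_range.2 (h_lt i k), iterate_mod_minimalPeriod_eq⟩
      · rintro ⟨k, hk, rfl⟩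
        exact ⟨k, (Finset.mem_range.1 hk).trans_le (h_le i), rfl⟩
    rw [h_image, Finset.sum_image (by simpa using iterate_injOn_Iio_minimalPeriod)]
    exact (h_per i).2
  have h_odd : ∀ (I : Finset (Fin 8)) (L : ℕ), (∀ i ∈ I, minimalPeriod R (e i) = L) →
      (∀ i ∈ I, ∀ j ∈ I, j ∈ faceOrbit m i → i = j) → Odd I.card →
      ∃ j, (∀ i ∈ I, j ∉ faceOrbit m i) ∧ minimalPeriod R (e j) = L := by
    intro I L hL h_inj h_card
    have h_image : (I.image fun i => (Quotient.mk _ (e i) : CycleQuotient R)).card = I.card :=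
      Finset.card_image_of_injOn fun i hi j hj hij =>
        h_inj i hi j hj ((h_mem i j).2 (cycleQuotient_mk_eq.1 hij))
    obtain ⟨_, ⟨j, rfl⟩, hj, hjL⟩ := exists_cycle_of_odd_card hR hι hι_ne hκ_ne hH hκ hJ hJ_ne
      hJR hJ_ne' (I.image fun i => Quotient.mk _ (e i)) (by rwa [h_image]) L (by
        intro q hq
        obtain ⟨i, hi, rfl⟩ := Finset.mem_image.1 hq
        exact ⟨_, ⟨i, rfl⟩, rfl, hL i hi⟩)
    refine ⟨j, fun i hi hij => hj (Finset.mem_image.2 ⟨i, hi, ?_⟩), hjL⟩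
    exact cycleQuotient_mk_eq.2 ((h_mem i j).1 hij)
  have h_symm : ∀ i j, i ∈ faceOrbit m j → j ∈ faceOrbit m i := fun i j h =>
    (h_mem i j).2 ((h_mem j i).1 h).symm
  have h_self : ∀ i, i ∈ faceOrbit m i := fun i => (h_mem i i).2 (Perm.SameCycle.refl _ _)
  refine false_of_even_faces hm hm_ne hNm hN_pos hW ?_ ?_ ?_
  · intro i j h
    exact (minimalPeriod_eq_of_sameCycle ((h_mem j i).1 h)).symm
  · intro i
    obtain ⟨j, hj, hjL⟩ := h_odd {i} (minimalPeriod R (e i)) (by simp) (by simp) (by simp)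
    exact ⟨j, hj i (by simp), hjL⟩
  · intro i j k hji hki hkj hjW hkW
    have hij_ne : i ≠ j := by rintro rfl; exact hji (h_self i)
    have hik_ne : i ≠ k := by rintro rfl; exact hki (h_self i)
    have hjk_ne : j ≠ k := by rintro rfl; exact hkj (h_self j)
    have hij : i ∉ faceOrbit m j := fun h => hji (h_symm _ _ h)
    have hik : i ∉ faceOrbit m k := fun h => hki (h_symm _ _ h)
    have hjk : j ∉ faceOrbit m k := fun h => hkj (h_symm _ _ h)
    obtain ⟨l, hl, hlL⟩ := h_odd {i, j, k} (minimalPeriod R (e i)) (by simp [hjW, hkW])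
      (by simp [hij, hik, hjk, hji, hki, hkj])
      (by rw [Finset.card_eq_three.2 ⟨i, j, k, hij_ne, hik_ne, hjk_ne, rfl⟩]; decide)
    exact ⟨l, hl i (by simp), hl j (by simp), hl k (by simp), hlL⟩

section CycleType

variable {α : Type*} [Fintype α] [DecidableEq α] {σ : Perm α}

theorem support_eq_univ_of_fullCycleType (h : 1 ∉ fullCycleType σ) :
    σ.support = Finset.univ := by
  have h_zero : Fintype.card α - σ.cycleType.sum = 0 := by
    by_contra h_ne
    exact h (Multiset.mem_add.2 (Or.inr (Multiset.mem_replicate.2 ⟨h_ne, rfl⟩)))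
  rw [Perm.sum_cycleType, Nat.sub_eq_zero_iff_le] at h_zero
  exact Finset.eq_univ_of_card _ (le_antisymm (Finset.card_le_univ _) h_zero)

theorem cycleType_eq_fullCycleType (h : 1 ∉ fullCycleType σ) :
    σ.cycleType = fullCycleType σ := by
  rw [fullCycleType, Perm.sum_cycleType, support_eq_univ_of_fullCycleType h, Finset.card_univ,
    Nat.sub_self, Multiset.replicate_zero, add_zero]

theorem pow_apply_eq_self_iff_card_dvd {c : Perm α} (hc : c ∈ σ.cycleFactorsFinset) {x : α}
    (hx : x ∈ c.support) (k : ℕ) : (σ ^ k) x = x ↔ c.support.card ∣ k := by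
  have hc' := Perm.cycle_is_cycleOf hx hc
  have h_cycle := (Perm.mem_cycleFactorsFinset_iff.1 hc).1
  rw [← Perm.cycleOf_pow_apply_self, ← hc', ← h_cycle.orderOf, orderOf_dvd_iff_pow_eq_one,
    h_cycle.pow_eq_one_iff' (Perm.mem_support.1 hx)]

theorem exists_pow_apply_eq_self_iff_dvd {x : α} (hx : σ x ≠ x) :
    ∃ L ∈ σ.cycleType, ∀ k, (σ ^ k) x = x ↔ L ∣ k := by
  have h_mem := Perm.cycleOf_mem_cycleFactorsFinset_iff.2 (Perm.mem_support.2 hx)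
  refine ⟨_, ?_, pow_apply_eq_self_iff_card_dvd h_mem
    (Perm.mem_support_cycleOf_iff.2 ⟨Perm.SameCycle.refl _ _, Perm.mem_support.2 hx⟩)⟩
  rw [Perm.cycleType_def]
  exact Multiset.mem_map_of_mem _ h_mem

theorem exists_pow_apply_eq_of_mem_support {c : Perm α} (hc : c ∈ σ.cycleFactorsFinset) {x y : α}
    (hx : x ∈ c.support) (hy : y ∈ c.support) : ∃ k : ℕ, (σ ^ k) x = y := by
  rw [Perm.cycle_is_cycleOf hx hc, Perm.mem_support_cycleOf_iff] at hy
  exact hy.1.exists_nat_pow_eq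

theorem pow_apply_eq_self_iff_of_fullCycleType_eq_replicate {l d : ℕ} (hd : d ≠ 1)
    (h : fullCycleType σ = Multiset.replicate l d) (x : α) (k : ℕ) : (σ ^ k) x = x ↔ d ∣ k := by
  have h_one : 1 ∉ fullCycleType σ := by
    rw [h]
    exact fun h' => hd (Multiset.eq_of_mem_replicate h').symm
  have hx : x ∈ σ.support := by simp [support_eq_univ_of_fullCycleType h_one]
  obtain ⟨L, hL, hLk⟩ := exists_pow_apply_eq_self_iff_dvd (Perm.mem_support.1 hx)
  rw [cycleType_eq_fullCycleType h_one, h] at hL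
  rw [hLk, Multiset.eq_of_mem_replicate hL]

theorem exists_pow_apply_eq_self_iff_of_fullCycleType_eq {l : ℕ}
    (h : fullCycleType σ = 3 ::ₘ 5 ::ₘ Multiset.replicate l 4) :
    ∃ p q, (∀ k, (σ ^ k) p = p ↔ 3 ∣ k) ∧ (∀ k, (σ ^ k) q = q ↔ 5 ∣ k) ∧
      ∀ x, (∃ k, (σ ^ k) p = x) ∨ (∃ k, (σ ^ k) q = x) ∨ ∀ k, (σ ^ k) x = x ↔ 4 ∣ k := by
  have h_one : 1 ∉ fullCycleType σ := by
    rw [h]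
    simp [Multiset.mem_replicate]
  have h_type := (cycleType_eq_fullCycleType h_one).trans h
  rw [Perm.cycleType_def, ← Multiset.map_eq_cons] at h_type
  obtain ⟨c, hc, hc_card, h_type⟩ := h_type
  rw [← Multiset.map_eq_cons] at h_type
  obtain ⟨d, hd, hd_card, h_type⟩ := h_type
  have hd' : d ∈ σ.cycleFactorsFinset := Multiset.mem_of_mem_erase hd
  obtain ⟨p, hp⟩ := Finset.card_pos.1 (show 0 < c.support.card by rw [comp_apply] at hc_card; omega)
  obtain ⟨q, hq⟩ := Finset.card_pos.1 (show 0 < d.support.card by rw [comp_apply] at hd_card; omega)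
  refine ⟨p, q, fun k => ?_, fun k => ?_, fun x => ?_⟩
  · rw [pow_apply_eq_self_iff_card_dvd hc hp, ← hc_card, comp_apply]
  · rw [pow_apply_eq_self_iff_card_dvd hd' hq, ← hd_card, comp_apply]
  · have hx : x ∈ σ.support := by simp [support_eq_univ_of_fullCycleType h_one]
    have h_mem := Perm.cycleOf_mem_cycleFactorsFinset_iff.2 hx
    have hx' := Perm.mem_support_cycleOf_iff.2 ⟨Perm.SameCycle.refl σ x, hx⟩
    by_cases hxc : σ.cycleOf x = c
    · exact Or.inl (exists_pow_apply_eq_of_mem_support hc hp (hxc ▸ hx'))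
    by_cases hxd : σ.cycleOf x = d
    · exact Or.inr (Or.inl (exists_pow_apply_eq_of_mem_support hd' hq (hxd ▸ hx')))
    · refine Or.inr (Or.inr fun k => ?_)
      rw [pow_apply_eq_self_iff_card_dvd h_mem hx']
      have h_card : (Finset.card ∘ Perm.support) (σ.cycleOf x) ∈ Multiset.replicate l 4 := by
        rw [← h_type]
        exact Multiset.mem_map_of_mem _
          ((Multiset.mem_erase_of_ne hxd).2 ((Multiset.mem_erase_of_ne hxc).2 h_mem))
      rw [← Multiset.eq_of_mem_replicate h_card, comp_apply]

end CycleType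

/-- Points on a 3-cycle and on a 5-cycle of `b`, listed along the cycles of `b ^ 2`. -/
theorem exists_corners {α : Type*} {b : Perm α} {p q : α} (hp : ∀ k, (b ^ k) p = p ↔ 3 ∣ k)
    (hq : ∀ k, (b ^ k) q = q ↔ 5 ∣ k) :
    ∃ e : Fin 8 → α, Injective e ∧ (∀ i, (b ^ 2) (e i) = e (corner i)) ∧
      (∀ k, (b ^ k) p ∈ Set.range e) ∧ ∀ k, (b ^ k) q ∈ Set.range e := by
  let r : Fin 8 → ℕ := ![0, 2, 1, 0, 2, 4, 1, 3]
  let e : Fin 8 → α := fun i => (b ^ r i) (if i < 3 then p else q)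
  have hp_mod : ∀ k, (b ^ k) p = (b ^ (k % 3)) p := by
    intro k
    conv_lhs => rw [← Nat.mod_add_div k 3, pow_add, Perm.mul_apply, (hp _).2 ⟨_, rfl⟩]
  have hq_mod : ∀ k, (b ^ k) q = (b ^ (k % 5)) q := by
    intro k
    conv_lhs => rw [← Nat.mod_add_div k 5, pow_add, Perm.mul_apply, (hq _).2 ⟨_, rfl⟩]
  have h_pow : ∀ x i j, i ≤ j → (b ^ i) x = (b ^ j) x → (b ^ (j - i)) x = x := by
    intro x i j hij h
    refine (b ^ i).injective ?_
    rw [h, ← Perm.mul_apply, ← pow_add, Nat.add_sub_cancel' hij]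
  have hpq : ∀ i j, (b ^ i) p ≠ (b ^ j) q := by
    intro i j h
    have h15 : (b ^ 5) p = p := by
      refine (b ^ i).injective ?_
      rw [← Perm.mul_apply, ← pow_add, add_comm, pow_add, Perm.mul_apply, h, ← Perm.mul_apply,
        ← pow_add, add_comm, pow_add, Perm.mul_apply, (hq 5).2 dvd_rfl]
    have := (hp 5).1 h15
    omega
  have h_le : ∀ i j : Fin 8, r i ≤ r j → e i = e j → i = j := by
    intro i j hij h
    by_cases hi : i < 3 <;> by_cases hj : j < 3 <;> simp only [e, hi, hj, if_true, if_false] at h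
    · have h3 := (hp _).1 (h_pow p _ _ hij h)
      clear h
      revert i j
      decide
    · exact absurd h (hpq _ _)
    · exact absurd h.symm (hpq _ _)
    · have h5 := (hq _).1 (h_pow q _ _ hij h)
      clear h
      revert i j
      decide
  refine ⟨e, ?_, ?_, ?_, ?_⟩
  · intro i j h
    rcases le_total (r i) (r j) with hij | hij
    · exact h_le i j hij h
    · exact (h_le j i hij h.symm).symm
  · intro i
    simp only [e]
    rw [← Perm.mul_apply, ← pow_add]
    by_cases hi : i < 3
    · have hi' : corner i < 3 := by revert i; decide
      rw [if_pos hi, if_pos hi', hp_mod, hp_mod (r (corner i))]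
      congr 2
      revert i
      decide
    · have hi' : ¬ corner i < 3 := by revert i; decide
      rw [if_neg hi, if_neg hi', hq_mod, hq_mod (r (corner i))]
      congr 2
      revert i
      decide
  · intro k
    obtain ⟨i, hi, hik⟩ : ∃ i : Fin 8, i < 3 ∧ r i = k % 3 := by
      have : ∀ k < 3, ∃ i : Fin 8, i < 3 ∧ r i = k := by decide
      exact this _ (Nat.mod_lt _ (by norm_num))
    exact ⟨i, by simp only [e]; rw [if_pos hi, hik, ← hp_mod]⟩
  · intro k
    obtain ⟨i, hi, hik⟩ : ∃ i : Fin 8, ¬ i < 3 ∧ r i = k % 5 := by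
      have : ∀ k < 5, ∃ i : Fin 8, ¬ i < 3 ∧ r i = k := by decide
      exact this _ (Nat.mod_lt _ (by norm_num))
    exact ⟨i, by simp only [e]; rw [if_neg hi, hik, ← hq_mod]⟩

theorem false_of_mul_eq_one {α : Type*} [Fintype α] [DecidableEq α] {a b c : Perm α}
    {l l' l'' : ℕ} (habc : a * b * c = 1) (ha : fullCycleType a = Multiset.replicate l 2)
    (hb : fullCycleType b = 3 ::ₘ 5 ::ₘ Multiset.replicate l' 4)
    (hc : fullCycleType c = Multiset.replicate l'' 4) : False := by
  have ha := pow_apply_eq_self_iff_of_fullCycleType_eq_replicate (by norm_num) ha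
  have hc := pow_apply_eq_self_iff_of_fullCycleType_eq_replicate (by norm_num) hc
  obtain ⟨p, q, hp, hq, hx⟩ := exists_pow_apply_eq_self_iff_of_fullCycleType_eq hb
  obtain ⟨e, he, h_corner, hp_mem, hq_mem⟩ := exists_corners hp hq
  have haa : a * a = 1 := by
    ext1 x
    rw [← pow_two]
    exact (ha x 2).2 dvd_rfl
  have ha_ne : ∀ x, a x ≠ x := by
    intro x h
    have := (ha x 1).1 h
    omega
  have hb_ne : ∀ x, (b ^ 2) x ≠ x := by
    intro x h
    rcases hx x with ⟨k, rfl⟩ | ⟨k, rfl⟩ | h4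
    · rw [← Perm.mul_apply, ← pow_add, add_comm, pow_add, Perm.mul_apply,
        EmbeddingLike.apply_eq_iff_eq, hp] at h
      omega
    · rw [← Perm.mul_apply, ← pow_add, add_comm, pow_add, Perm.mul_apply,
        EmbeddingLike.apply_eq_iff_eq, hq] at h
      omega
    · have := (h4 2).1 h
      omega
  -- `b * a` is conjugate to `a * b = c⁻¹`
  have hg : ∀ x k, ((b * a) ^ k) x = x ↔ 4 ∣ k := by
    intro x k
    have h_conj : b * a = a⁻¹ * c⁻¹ * a⁻¹⁻¹ := by
      rw [← eq_inv_of_mul_eq_one_left habc]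
      group
    rw [h_conj, conj_pow, inv_pow, inv_inv, Perm.mul_apply, Perm.mul_apply, Perm.inv_eq_iff_eq,
      Perm.inv_eq_iff_eq, eq_comm, hc]
  set g := b * a with hg_def
  have hg4 : g ^ 4 = 1 := by
    ext1 x
    exact (hg x 4).2 dvd_rfl
  have hR : b ^ 2 * a = g * (a * g) := by
    simp only [hg_def, pow_two, mul_assoc]
    rw [← mul_assoc a a, haa, one_mul]
  refine false_of_reversal (R := b ^ 2 * a) (ι := a) (κ := b ^ 2) (J := g ^ 2) he h_corner rfl
    (fun x => by rw [← Perm.mul_apply, haa, Perm.one_apply]) ha_ne hb_ne ?_ ?_ ?_ ?_ ?_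
  · intro x hxe
    rcases hx x with ⟨k, rfl⟩ | ⟨k, rfl⟩ | h4
    · exact absurd (hp_mem k) hxe
    · exact absurd (hq_mem k) hxe
    · rw [← Perm.mul_apply, ← pow_add]
      exact (h4 4).2 dvd_rfl
  · intro x
    rw [← Perm.mul_apply, ← pow_add, hg4, Perm.one_apply]
  · intro x h
    have := (hg x 2).1 h
    omega
  · intro x
    simp only [← Perm.mul_apply]
    congr 1
    calc b ^ 2 * a * (g ^ 2 * (b ^ 2 * a)) = g * a * g ^ 4 * (a * g) := by rw [hR]; group
      _ = g * (a * a) * g := by rw [hg4]; group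
      _ = g ^ 2 := by rw [haa, mul_one, pow_two]
  · intro x h
    rw [hR, pow_two] at h
    exact ha_ne _ (g.injective h).symm

end

/-- The genus-1 ramification type (C): [2^*][3,5,4^*][4^*] is not realizable in any degree. -/
theorem stmt8 (n : ℕ) (hn : 8 ≤ n) (h4 : 4 ∣ n) :
    ¬ Realizable n
      [Multiset.replicate (n / 2) 2,
        3 ::ₘ 5 ::ₘ Multiset.replicate ((n - 8) / 4) 4,
        Multiset.replicate (n / 4) 4] := by
  rintro ⟨σ, h_type, h_prod, -⟩
  obtain ⟨a, σ, rfl, ha, h_type⟩ := List.map_eq_cons_iff.1 h_type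
  obtain ⟨b, σ, rfl, hb, h_type⟩ := List.map_eq_cons_iff.1 h_type
  obtain ⟨c, σ, rfl, hc, h_type⟩ := List.map_eq_cons_iff.1 h_type
  obtain rfl := List.map_eq_nil_iff.1 h_type
  exact false_of_mul_eq_one (by simpa [mul_assoc] using h_prod) ha hb hc
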